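/- arXiv:2506.12740 — 3 statements merged into one kernel-verified Lean document; each statement's English description precedes it below -/
import Mathlib

section
/- Let G be a finite simple graph and v a vertex of G. Then d(G) = d(G − v) + d(G − N[v]) + Σ_{u ∈ N(v)} d(G − (N[u] ∪ N[v])), where the sum ranges over the neighbors u of v. -/
open SimpleGraph

/-- `S` is a dissociation set of `G`: every vertex of `S` has at most one neighbor in `S`. -/
def IsDissociation {V : Type*} (G : SimpleGraph V) (S : Set V) : Prop :=
  ∀ v ∈ S, (G.neighborSet v ∩ S).Subsingleton

/-- `d(G)`: the number of dissociation sets of `G`. -/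
noncomputable def dissocNum {V : Type*} (G : SimpleGraph V) : ℕ :=
  Nat.card {S : Set V // IsDissociation G S}

/-- `K_{r+1} ∗ (K_{s₀+1} ∪ ⋯ ∪ K_{sₜ+1})`: the hub `Sum.inl 0` of the complete graph
`K_{r+1}` is joined to the vertex `0` of each complete component. -/
def starGraph (r : ℕ) (s : List ℕ) :
    SimpleGraph (Fin (r + 1) ⊕ (Σ i : Fin s.length, Fin (s.get i + 1))) where
  Adj x y := x ≠ y ∧
    (Sum.elim (fun _ => (none : Option (Fin s.length))) (fun p => some p.1) x =
        Sum.elim (fun _ => (none : Option (Fin s.length))) (fun p => some p.1) y ∨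
      (x = Sum.inl 0 ∧ ∃ i, y = Sum.inr ⟨i, 0⟩) ∨
      (y = Sum.inl 0 ∧ ∃ i, x = Sum.inr ⟨i, 0⟩))
  symm := by
    constructor
    rintro x y ⟨h1, h2⟩
    refine ⟨h1.symm, ?_⟩
    rcases h2 with h | h | h
    · exact Or.inl h.symm
    · exact Or.inr (Or.inr h)
    · exact Or.inr (Or.inl h)
  loopless := ⟨fun x h => h.1 rfl⟩

/-- The closed neighborhood `N[v]` of a vertex. -/
def closedNbhd {V : Type*} (G : SimpleGraph V) (v : V) : Set V :=
  insert v (G.neighborSet v)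

/-- Dissociation sets of `G.induce A` correspond to the dissociation sets of `G` whose part outside
`A` is a fixed dissociation set `T` with no edges to `A`. -/
theorem dissocNum_induce_eq_ncard {V : Type*} (G : SimpleGraph V) {A T : Set V}
    (hT : IsDissociation G T) (hTA : T ⊆ Aᶜ) (hadj : ∀ t ∈ T, ∀ a ∈ A, ¬ G.Adj t a) :
    dissocNum (G.induce A) = {S : Set V | IsDissociation G S ∧ S ∩ Aᶜ = T}.ncard := by
  refine Nat.card_congr
    { toFun := fun S => ⟨Subtype.val '' S.1 ∪ T, ?_, ?_⟩
      invFun := fun S => ⟨Subtype.val ⁻¹' S.1, ?_⟩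
      left_inv := ?_
      right_inv := ?_ }
  · rintro x (⟨a, ha, rfl⟩ | hx) y ⟨hxy, hy⟩ z ⟨hxz, hz⟩
    · rcases hy with ⟨b, hb, rfl⟩ | hy
      · rcases hz with ⟨c, hc, rfl⟩ | hz
        · exact congrArg Subtype.val (S.2 a ha ⟨hxy, hb⟩ ⟨hxz, hc⟩)
        · exact (hadj z hz a a.2 hxz.symm).elim
      · exact (hadj y hy a a.2 hxy.symm).elim
    · rcases hy with ⟨b, hb, rfl⟩ | hy
      · exact (hadj x hx b b.2 hxy).elim
      · rcases hz with ⟨c, hc, rfl⟩ | hz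
        · exact (hadj x hx c c.2 hxz).elim
        · exact hT x hx ⟨hxy, hy⟩ ⟨hxz, hz⟩
  · ext x
    constructor
    · rintro ⟨⟨a, -, rfl⟩ | hx, hxA⟩
      · exact (hxA a.2).elim
      · exact hx
    · exact fun hx => ⟨Or.inr hx, hTA hx⟩
  · exact fun x hx y hy z hz => Subtype.ext (S.2.1 x hx ⟨hy.1, hy.2⟩ ⟨hz.1, hz.2⟩)
  · rintro ⟨S, hS⟩
    refine Subtype.ext (Set.ext fun x => ⟨?_, fun hx => Or.inl ⟨x, hx, rfl⟩⟩)
    rintro (⟨a, ha, h⟩ | hx)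
    · exact Subtype.ext h ▸ ha
    · exact (hTA hx x.2).elim
  · rintro ⟨S, hS, rfl⟩
    refine Subtype.ext (Set.ext fun x => ⟨?_, fun hx => ?_⟩)
    · rintro (⟨a, ha, rfl⟩ | hx)
      · exact ha
      · exact hx.1
    · by_cases hxA : x ∈ A
      · exact Or.inl ⟨⟨x, hxA⟩, hx, rfl⟩
      · exact Or.inr ⟨hx, hxA⟩

/-- If `S` is a dissociation set containing the adjacent vertices `u` and `v`, it contains no other
vertex of their closed neighborhoods. -/
theorem IsDissociation.inter_closedNbhd_union {V : Type*} {G : SimpleGraph V} {S : Set V}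
    (hS : IsDissociation G S) {u v : V} (hu : u ∈ S) (hv : v ∈ S) (huv : G.Adj v u) :
    S ∩ (closedNbhd G u ∪ closedNbhd G v) = {u, v} := by
  ext x
  constructor
  · rintro ⟨hx, (rfl | hxu) | (rfl | hxv)⟩
    · exact Or.inl rfl
    · exact Or.inr (hS u hu ⟨hxu, hx⟩ ⟨huv.symm, hv⟩)
    · exact Or.inr rfl
    · exact Or.inl (hS v hv ⟨hxv, hx⟩ ⟨huv, hu⟩)
  · rintro (rfl | rfl)
    · exact ⟨hu, Or.inl (Or.inl rfl)⟩
    · exact ⟨hv, Or.inr (Or.inl rfl)⟩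

/-- Deletion identity: `d(G) = d(G − v) + d(G − N[v]) + Σ_{u ∈ N(v)} d(G − (N[u] ∪ N[v]))`. -/
theorem dissocNum_deletion {V : Type*} [Fintype V] (G : SimpleGraph V) (v : V) :
    dissocNum G =
      dissocNum (G.induce ({v}ᶜ : Set V)) +
      dissocNum (G.induce ((closedNbhd G v)ᶜ : Set V)) +
      ∑ᶠ u ∈ G.neighborSet v,
        dissocNum (G.induce ((closedNbhd G u ∪ closedNbhd G v)ᶜ : Set V)) := by
  have h₁ := dissocNum_induce_eq_ncard G (A := {v}ᶜ) (T := ∅) (fun _ h => h.elim)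
    (Set.empty_subset _) (fun _ h => h.elim)
  have h₂ := dissocNum_induce_eq_ncard G (A := (closedNbhd G v)ᶜ) (T := {v})
    (by rintro _ rfl x ⟨hx, rfl⟩; exact (G.irrefl hx).elim)
    (by rintro _ rfl h; exact h (Or.inl rfl))
    (by rintro _ rfl a ha h; exact ha (Or.inr h))
  have h₃ (u : V) (hu : u ∈ G.neighborSet v) :=
    dissocNum_induce_eq_ncard G (A := (closedNbhd G u ∪ closedNbhd G v)ᶜ) (T := {u, v})
      (by
        rintro x (rfl | rfl) y ⟨hy, rfl | rfl⟩ z ⟨hz, rfl | rfl⟩ <;>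
          first | rfl | exact (G.irrefl hy).elim | exact (G.irrefl hz).elim)
      (by
        rintro _ (rfl | rfl) h
        · exact h (Or.inl (Or.inl rfl))
        · exact h (Or.inr (Or.inl rfl)))
      (by
        rintro _ (rfl | rfl) a ha h
        · exact ha (Or.inl (Or.inr h))
        · exact ha (Or.inr (Or.inr h)))
  rw [h₁, h₂, finsum_mem_congr rfl h₃]
  simp only [compl_compl]
  set W₁ := {S : Set V | IsDissociation G S ∧ S ∩ {v} = ∅}
  set W₂ := {S : Set V | IsDissociation G S ∧ S ∩ closedNbhd G v = {v}}
  let W₃ (u : V) :=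
    {S : Set V | IsDissociation G S ∧ S ∩ (closedNbhd G u ∪ closedNbhd G v) = {u, v}}
  have mem₁ {S : Set V} (hS : S ∈ W₁) : v ∉ S := fun hv =>
    (hS.2 ▸ (⟨hv, rfl⟩ : v ∈ S ∩ {v}) : v ∈ (∅ : Set V))
  have mem₂ {S : Set V} (hS : S ∈ W₂) : v ∈ S :=
    (hS.2.symm ▸ rfl : v ∈ S ∩ closedNbhd G v).1
  have mem₃ {S : Set V} {u : V} (hS : S ∈ W₃ u) : u ∈ S ∧ v ∈ S :=
    ⟨(hS.2.symm ▸ Or.inl rfl : u ∈ S ∩ (closedNbhd G u ∪ closedNbhd G v)).1,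
      (hS.2.symm ▸ Or.inr rfl : v ∈ S ∩ (closedNbhd G u ∪ closedNbhd G v)).1⟩
  have hW : {S : Set V | IsDissociation G S} = (W₁ ∪ W₂) ∪ ⋃ u ∈ G.neighborSet v, W₃ u := by
    ext S
    simp only [Set.mem_union, Set.mem_iUnion]
    constructor
    · intro hS
      by_cases hv : v ∈ S
      · by_cases hu : ∃ u ∈ G.neighborSet v, u ∈ S
        · obtain ⟨u, huv, hu⟩ := hu
          exact Or.inr ⟨u, huv, hS, hS.inter_closedNbhd_union hu hv huv⟩
        · refine Or.inl (Or.inr ⟨hS, Set.ext fun x => ⟨?_, ?_⟩⟩)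
          · rintro ⟨hx, rfl | hxv⟩
            · rfl
            · exact (hu ⟨x, hxv, hx⟩).elim
          · rintro rfl
            exact ⟨hv, Or.inl rfl⟩
      · exact Or.inl (Or.inl ⟨hS, Set.inter_singleton_eq_empty.mpr hv⟩)
    · rintro ((h | h) | ⟨u, -, h⟩) <;> exact h.1
  have hd₁₂ : Disjoint W₁ W₂ := Set.disjoint_left.mpr fun S h h' => mem₁ h (mem₂ h')
  have hd₃ : Disjoint (W₁ ∪ W₂) (⋃ u ∈ G.neighborSet v, W₃ u) := by
    refine Set.disjoint_left.mpr fun S h h' => ?_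
    obtain ⟨u, huv, hu⟩ := Set.mem_iUnion₂.mp h'
    rcases h with h | h
    · exact mem₁ h (mem₃ hu).2
    · have : u ∈ ({v} : Set V) := h.2 ▸ ⟨(mem₃ hu).1, Or.inr huv⟩
      exact G.ne_of_adj huv this.symm
  have hpd : (G.neighborSet v).PairwiseDisjoint W₃ := fun u hu w hw huw =>
    Set.disjoint_left.mpr fun S h h' =>
      huw (h.1 v (mem₃ h).2 ⟨hu, (mem₃ h).1⟩ ⟨hw, (mem₃ h').1⟩)
  calc dissocNum G = {S : Set V | IsDissociation G S}.ncard := rfl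
    _ = W₁.ncard + W₂.ncard + (⋃ u ∈ G.neighborSet v, W₃ u).ncard := by
      rw [hW, Set.ncard_union_eq hd₃, Set.ncard_union_eq hd₁₂]
    _ = _ := by
      rw [Set.Finite.ncard_biUnion (Set.toFinite _) (fun _ _ => Set.toFinite _) hpd]
end

section
/- Let G be a finite simple graph and uv an edge of G. Then d(G) ≤ d(G − uv), where G − uv is the graph obtained from G by deleting the edge uv, and equality holds if and only if N_G[u] = N_G[v], i.e., u and v are true twins in G. -/
open SimpleGraph

/-- Removing edges preserves dissociation sets. -/
theorem IsDissociation.mono {V : Type*} {G H : SimpleGraph V} (hle : H ≤ G) {S : Set V}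
    (hS : IsDissociation G S) : IsDissociation H S :=
  fun x hx => (hS x hx).anti (Set.inter_subset_inter_left S fun _ hy => hle hy)

/-- If `G` and `G − uv` have the same dissociation sets, then every neighbor `w ≠ v` of `u` is
adjacent to `v`, as witnessed by the set `{u, v, w}`. -/
theorem adj_of_isDissociation_of_deleteEdges {V : Type*} {G : SimpleGraph V} {u v w : V}
    (h : G.Adj u v)
    (hG : ∀ S, IsDissociation (G.deleteEdges {s(u, v)}) S → IsDissociation G S)
    (huw : G.Adj u w) (hwv : w ≠ v) : G.Adj v w := by
  by_contra hvw
  have hS : IsDissociation (G.deleteEdges {s(u, v)}) {u, v, w} := by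
    rintro x hx y ⟨hxy, hy⟩ z ⟨hxz, hz⟩
    simp only [mem_neighborSet, deleteEdges_adj, Set.mem_singleton_iff, Sym2.eq_iff,
      Set.mem_insert_iff] at hx hxy hxz hy hz
    have := G.adj_comm
    have := fun x => G.loopless.irrefl x
    grind
  exact hwv (hG _ hS u (by simp) ⟨huw, by simp⟩ ⟨h, by simp⟩)

/-- Deleting an edge between true twins creates no new dissociation sets. -/
theorem IsDissociation.of_deleteEdges {V : Type*} {G : SimpleGraph V} {u v : V}
    (huv : insert u (G.neighborSet u) = insert v (G.neighborSet v)) {S : Set V}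
    (hS : IsDissociation (G.deleteEdges {s(u, v)}) S) : IsDissociation G S := by
  have htwin (x : V) : x = u ∨ G.Adj u x ↔ x = v ∨ G.Adj v x := by
    simpa using Set.ext_iff.1 huv x
  have hdel {a b c : V} (ha : a ∈ S) (hb : b ∈ S) (hc : c ∈ S) (hab : G.Adj a b)
      (hac : G.Adj a c) : s(a, b) = s(u, v) ∨ s(a, c) = s(u, v) ∨ b = c := by
    by_contra! hne
    exact hne.2.2 (hS a ha ⟨deleteEdges_adj.2 ⟨hab, hne.1⟩, hb⟩
      ⟨deleteEdges_adj.2 ⟨hac, hne.2.1⟩, hc⟩)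
  simp only [Sym2.eq_iff] at hdel
  rintro x hx y ⟨hxy : G.Adj x y, hy⟩ z ⟨hxz : G.Adj x z, hz⟩
  have hx' := hdel hx hy hz hxy hxz
  have hy' := hdel hy hx hz hxy.symm
  have hz' := hdel hz hx hy hxz.symm
  have hyu := htwin y
  have hzu := htwin z
  have := G.adj_comm y z
  have := hxy.ne
  have := hxz.ne
  grind

/-- Edge-deletion monotonicity: `d(G) ≤ d(G − uv)`, with equality iff `u, v` are
true twins, i.e. `N_G[u] = N_G[v]`. -/
theorem dissocNum_le_deleteEdge {V : Type*} [Fintype V] (G : SimpleGraph V) (u v : V)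
    (h : G.Adj u v) :
    dissocNum G ≤ dissocNum (G.deleteEdges {s(u, v)}) ∧
      (dissocNum G = dissocNum (G.deleteEdges {s(u, v)}) ↔
        insert u (G.neighborSet u) = insert v (G.neighborSet v)) := by
  have hsub : {S | IsDissociation G S} ⊆ {S | IsDissociation (G.deleteEdges {s(u, v)}) S} :=
    fun _ hS => hS.mono (deleteEdges_le _)
  refine ⟨Set.ncard_le_ncard hsub (Set.toFinite _), fun heq => ?_, fun huv => ?_⟩
  · have hset := Set.eq_of_subset_of_ncard_le hsub heq.ge (Set.toFinite _)
    have hG : ∀ S, IsDissociation (G.deleteEdges {s(u, v)}) S → IsDissociation G S :=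
      fun _ hS => hset.ge hS
    have huv (w : V) := adj_of_isDissociation_of_deleteEdges (w := w) h hG
    have hvu (w : V) := adj_of_isDissociation_of_deleteEdges (w := w) h.symm
      (by simpa only [Sym2.eq_swap] using hG)
    ext w
    simp only [Set.mem_insert_iff, mem_neighborSet]
    have := h.symm
    grind
  · exact congrArg Set.ncard
      (hsub.antisymm fun _ hS => IsDissociation.of_deleteEdges huv hS)
end

section
/- Let T be a tree of order 9 that is not isomorphic to K_1 ∗ 4K_2. Then d(T) ≤ 292, and equality holds if and only if T is isomorphic to K_1 ∗ (2K_1 ∪ 3K_2). -/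
open SimpleGraph

namespace SimpleGraph

variable {α β γ α' β' : Type*}

/-- The disjoint union of `G` and `H` together with an edge joining `a` to `b`. -/
def link (G : SimpleGraph α) (a : α) (H : SimpleGraph β) (b : β) : SimpleGraph (α ⊕ β) where
  Adj
    | .inl x, .inl y => G.Adj x y
    | .inr x, .inr y => H.Adj x y
    | .inl x, .inr y => x = a ∧ y = b
    | .inr y, .inl x => x = a ∧ y = b
  symm := ⟨by rintro (x | x) (y | y) <;> simp [adj_comm]⟩
  loopless := ⟨by rintro (x | x) <;> simp⟩

section link

variable (G : SimpleGraph α) (a : α) (H : SimpleGraph β) (b : β)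

@[simp] lemma link_adj_inl_inl {x y : α} :
    (link G a H b).Adj (.inl x) (.inl y) ↔ G.Adj x y := Iff.rfl

@[simp] lemma link_adj_inr_inr {x y : β} :
    (link G a H b).Adj (.inr x) (.inr y) ↔ H.Adj x y := Iff.rfl

@[simp] lemma link_adj_inl_inr {x : α} {y : β} :
    (link G a H b).Adj (.inl x) (.inr y) ↔ x = a ∧ y = b := Iff.rfl

@[simp] lemma link_adj_inr_inl {x : α} {y : β} :
    (link G a H b).Adj (.inr y) (.inl x) ↔ x = a ∧ y = b := Iff.rfl

/-- Linking respects isomorphisms. -/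
def linkCongr {G : SimpleGraph α} {H : SimpleGraph β} {G' : SimpleGraph α'} {H' : SimpleGraph β'}
    {a : α} {b : β} {a' : α'} {b' : β'} (e : G ≃g G') (f : H ≃g H') (ha : e a = a')
    (hb : f b = b') : link G a H b ≃g link G' a' H' b' where
  toEquiv := Equiv.sumCongr e.toEquiv f.toEquiv
  map_rel_iff' := by
    subst ha hb
    rintro (x | x) (y | y) <;> simp [Iso.map_adj_iff]

/-- Linking is commutative up to isomorphism. -/
def linkComm : link G a H b ≃g link H b G a where
  toEquiv := Equiv.sumComm α β
  map_rel_iff' := by rintro (x | x) (y | y) <;> simp [and_comm]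

/-- Linking a third graph to a vertex of the second one is associative. -/
def linkAssoc (b' : β) (K : SimpleGraph γ) (c : γ) :
    link (link G a H b) (.inr b') K c ≃g link G a (link H b' K c) (.inl b) where
  toEquiv := Equiv.sumAssoc α β γ
  map_rel_iff' := by rintro ((x | x) | x) ((y | y) | y) <;> simp

/-- Two graphs linked to a common graph may be linked in either order. -/
def linkSwap (a' : α) (K : SimpleGraph γ) (c : γ) :
    link (link G a H b) (.inl a') K c ≃g link (link G a' K c) (.inl a) H b where
  toEquiv := (Equiv.sumAssoc α β γ).trans
    ((Equiv.sumCongr (Equiv.refl α) (Equiv.sumComm β γ)).trans (Equiv.sumAssoc α γ β).symm)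
  map_rel_iff' := by rintro ((x | x) | x) ((y | y) | y) <;> simp

end link

/-- A graph is recovered from the deletion of a vertex whose only neighbor is `u`. -/
noncomputable def linkInduceComplIso (G : SimpleGraph α) (v u : α) (hvu : G.Adj v u)
    (hu : ∀ w, G.Adj v w → w = u) :
    link (G.induce {v}ᶜ) ⟨u, hvu.ne'⟩ (⊥ : SimpleGraph Unit) () ≃g G where
  toEquiv := Equiv.ofBijective (Sum.elim Subtype.val fun _ => v) <| by
    refine ⟨?_, fun x => ?_⟩
    · rintro (⟨x, hx⟩ | x) (⟨y, hy⟩ | y) h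
      · simpa using h
      · exact absurd h hx
      · exact absurd h.symm hy
      · rfl
    · by_cases hx : x = v
      · exact ⟨.inr (), hx.symm⟩
      · exact ⟨.inl ⟨x, hx⟩, rfl⟩
  map_rel_iff' := by
    have h (w : α) : G.Adj v w ↔ w = u := ⟨hu w, fun h => h ▸ hvu⟩
    rintro (⟨x, hx⟩ | x) (⟨y, hy⟩ | y)
    · exact Iff.rfl
    · exact (G.adj_comm x v).trans ((h x).trans
        ⟨fun e => ⟨Subtype.ext e, rfl⟩, fun e => congrArg Subtype.val e.1⟩)
    · exact (h y).trans ⟨fun e => ⟨Subtype.ext e, rfl⟩, fun e => congrArg Subtype.val e.1⟩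
    · simp

/-- The dissociation sets avoiding `r`. -/
def dissocAvoiding (G : SimpleGraph α) (r : α) : Set (Set α) :=
  {S | IsDissociation G S ∧ r ∉ S}

/-- The dissociation sets in which `r` is isolated. -/
def dissocIsolating (G : SimpleGraph α) (r : α) : Set (Set α) :=
  {S | IsDissociation G S ∧ r ∈ S ∧ ∀ v ∈ S, ¬ G.Adj r v}

/-- The dissociation sets in which `r` has a neighbor. -/
def dissocMatching (G : SimpleGraph α) (r : α) : Set (Set α) :=
  {S | IsDissociation G S ∧ r ∈ S ∧ ∃ v ∈ S, G.Adj r v}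

lemma setOf_isDissociation (G : SimpleGraph α) (r : α) :
    {S | IsDissociation G S} = G.dissocAvoiding r ∪ (G.dissocIsolating r ∪ G.dissocMatching r) := by
  ext S
  simp only [dissocAvoiding, dissocIsolating, dissocMatching, Set.mem_ofPred_eq, Set.mem_union]
  grind

lemma disjoint_dissocIsolating_dissocMatching (G : SimpleGraph α) (r : α) :
    Disjoint (G.dissocIsolating r) (G.dissocMatching r) :=
  Set.disjoint_left.2 fun _ h ⟨_, _, v, hv, hv'⟩ => h.2.2 v hv hv'

lemma ncard_setOf_isDissociation [Finite α] (G : SimpleGraph α) (r : α) :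
    {S | IsDissociation G S}.ncard =
      (G.dissocAvoiding r).ncard + (G.dissocIsolating r).ncard + (G.dissocMatching r).ncard := by
  rw [setOf_isDissociation G r, Set.ncard_union_eq, Set.ncard_union_eq, add_assoc]
  · exact disjoint_dissocIsolating_dissocMatching G r
  · rw [Set.disjoint_union_right]
    exact ⟨Set.disjoint_left.2 fun _ h h' => h.2 h'.2.1,
      Set.disjoint_left.2 fun _ h h' => h.2 h'.2.1⟩

/-- A set of vertices of a disjoint union, as a pair of sets of vertices. -/
def splitSet (α β : Type*) : Set (α ⊕ β) ≃ Set α × Set β where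
  toFun S := (Sum.inl ⁻¹' S, Sum.inr ⁻¹' S)
  invFun P := Sum.inl '' P.1 ∪ Sum.inr '' P.2
  left_inv S := by ext (x | x) <;> simp
  right_inv P := by ext x <;> simp

lemma ncard_splitSet_preimage (P : Set (Set α)) (Q : Set (Set β)) :
    (splitSet α β ⁻¹' (P ×ˢ Q)).ncard = P.ncard * Q.ncard := by
  rw [Set.ncard_preimage_of_injective_subset_range (splitSet α β).injective
    (by simp [(splitSet α β).surjective.range_eq]), Set.ncard_prod]

lemma isDissociation_link (G : SimpleGraph α) (a : α) (H : SimpleGraph β) (b : β)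
    (S : Set (α ⊕ β)) :
    IsDissociation (link G a H b) S ↔
      IsDissociation G (Sum.inl ⁻¹' S) ∧ IsDissociation H (Sum.inr ⁻¹' S) ∧
        (.inl a ∈ S → .inr b ∈ S →
          (∀ v, .inl v ∈ S → ¬ G.Adj a v) ∧ ∀ v, .inr v ∈ S → ¬ H.Adj b v) := by
  simp only [IsDissociation, Set.Subsingleton, Set.mem_inter_iff, mem_neighborSet, Sum.forall,
    link_adj_inl_inl, link_adj_inr_inr, link_adj_inl_inr, link_adj_inr_inl, Set.mem_preimage,
    Sum.inl.injEq, Sum.inr.injEq, reduceCtorEq]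
  grind

section count

variable (G : SimpleGraph α) (a : α) (H : SimpleGraph β) (b : β)

lemma ncard_dissocAvoiding_link :
    ((link G a H b).dissocAvoiding (.inl a)).ncard =
      (G.dissocAvoiding a).ncard * {S | IsDissociation H S}.ncard := by
  rw [← ncard_splitSet_preimage]
  congr 1
  ext S
  simp only [dissocAvoiding, isDissociation_link, splitSet, Equiv.coe_fn_mk, Set.mem_preimage,
    Set.mem_ofPred_eq, Set.mem_prod]
  tauto

lemma ncard_dissocIsolating_link :
    ((link G a H b).dissocIsolating (.inl a)).ncard =
      (G.dissocIsolating a).ncard * (H.dissocAvoiding b).ncard := by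
  rw [← ncard_splitSet_preimage]
  congr 1
  ext S
  simp only [dissocAvoiding, dissocIsolating, isDissociation_link, splitSet, Equiv.coe_fn_mk,
    Set.mem_preimage, Set.mem_ofPred_eq, Set.mem_prod, Sum.forall, link_adj_inl_inl,
    link_adj_inl_inr]
  grind

lemma ncard_dissocMatching_link [Finite α] [Finite β] :
    ((link G a H b).dissocMatching (.inl a)).ncard =
      (G.dissocMatching a).ncard * (H.dissocAvoiding b).ncard +
        (G.dissocIsolating a).ncard * (H.dissocIsolating b).ncard := by
  rw [← ncard_splitSet_preimage, ← ncard_splitSet_preimage, ← Set.ncard_union_eq]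
  · congr 1
    ext S
    simp only [dissocAvoiding, dissocIsolating, dissocMatching, isDissociation_link, splitSet,
      Equiv.coe_fn_mk, Set.mem_preimage, Set.mem_ofPred_eq, Set.mem_prod, Set.mem_union, Sum.exists,
      link_adj_inl_inl, link_adj_inl_inr]
    grind
  · refine Disjoint.preimage _ (Set.Disjoint.set_prod_left ?_ _ _)
    exact (disjoint_dissocIsolating_dissocMatching G a).symm

end count

lemma _root_.IsDissociation.preimage_iso {G : SimpleGraph α} {H : SimpleGraph β} (e : G ≃g H)
    {S : Set β} (hS : IsDissociation H S) : IsDissociation G (e ⁻¹' S) :=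
  fun v hv _ hx _ hy => e.injective <|
    hS (e v) hv ⟨e.map_adj_iff.2 hx.1, hx.2⟩ ⟨e.map_adj_iff.2 hy.1, hy.2⟩

lemma dissocNum_congr {G : SimpleGraph α} {H : SimpleGraph β} (e : G ≃g H) :
    dissocNum G = dissocNum H :=
  Nat.card_congr
    { toFun S := ⟨e.symm ⁻¹' S.1, S.2.preimage_iso e.symm⟩
      invFun S := ⟨e ⁻¹' S.1, S.2.preimage_iso e⟩
      left_inv S := by ext; simp
      right_inv S := by ext; simp }

end SimpleGraph

/-- Rooted plane trees: `join a b` attaches the root of `b` as a new child of the root of `a`. -/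
inductive PlaneTree where
  | leaf : PlaneTree
  | join : PlaneTree → PlaneTree → PlaneTree

namespace PlaneTree

instance decidableEq : DecidableEq PlaneTree
  | leaf, leaf => isTrue rfl
  | leaf, join _ _ => isFalse nofun
  | join _ _, leaf => isFalse nofun
  | join a b, join c d =>
    have := decidableEq a c
    have := decidableEq b d
    decidable_of_iff (a = c ∧ b = d) (by simp)

/-- The number of vertices. -/
def size : PlaneTree → ℕ
  | leaf => 1
  | join a b => a.size + b.size

/-- The vertex type. -/
def Vertex : PlaneTree → Type
  | leaf => Unit
  | join a b => a.Vertex ⊕ b.Vertex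

/-- The root. -/
def root : (t : PlaneTree) → t.Vertex
  | leaf => ()
  | join a _ => .inl a.root

/-- The underlying graph. -/
def graph : (t : PlaneTree) → SimpleGraph t.Vertex
  | leaf => ⊥
  | join a b => link a.graph a.root b.graph b.root

instance fintypeVertex : (t : PlaneTree) → Fintype t.Vertex
  | leaf => inferInstanceAs (Fintype Unit)
  | join a b =>
    have := fintypeVertex a
    have := fintypeVertex b
    inferInstanceAs (Fintype (a.Vertex ⊕ b.Vertex))

/-- The numbers of dissociation sets avoiding the root, isolating it and matching it. -/
def counts : PlaneTree → ℕ × ℕ × ℕ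
  | leaf => (1, 1, 0)
  | join a b =>
    (a.counts.1 * (b.counts.1 + b.counts.2.1 + b.counts.2.2), a.counts.2.1 * b.counts.1,
      a.counts.2.2 * b.counts.1 + a.counts.2.1 * b.counts.2.1)

/-- The number of dissociation sets, computed recursively. -/
def total (t : PlaneTree) : ℕ := t.counts.1 + t.counts.2.1 + t.counts.2.2

lemma counts_eq (t : PlaneTree) :
    t.counts = ((t.graph.dissocAvoiding t.root).ncard, (t.graph.dissocIsolating t.root).ncard,
      (t.graph.dissocMatching t.root).ncard) := by
  induction t with
  | leaf =>
    have h (S : Set Unit) : IsDissociation ⊥ S := fun _ _ _ _ _ _ => rfl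
    have h₁ : dissocAvoiding (⊥ : SimpleGraph Unit) () = {∅} := by
      ext S
      simp only [dissocAvoiding, h, Set.mem_ofPred_eq, true_and, Set.mem_singleton_iff,
        Set.eq_empty_iff_forall_notMem]
      exact (forall_const Unit).symm
    have h₂ : dissocIsolating (⊥ : SimpleGraph Unit) () = {Set.univ} := by
      ext S
      simp only [dissocIsolating, h, Set.mem_ofPred_eq, true_and, Set.mem_singleton_iff,
        Set.eq_univ_iff_forall, bot_adj, not_false_eq_true, implies_true, and_true]
      exact (forall_const Unit).symm
    have h₃ : dissocMatching (⊥ : SimpleGraph Unit) () = ∅ := by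
      ext S
      simp [dissocMatching]
    change _ = ((dissocAvoiding (⊥ : SimpleGraph Unit) ()).ncard,
      (dissocIsolating (⊥ : SimpleGraph Unit) ()).ncard,
      (dissocMatching (⊥ : SimpleGraph Unit) ()).ncard)
    simp [h₁, h₂, h₃, counts]
  | join a b iha ihb =>
    simp only [counts, iha, ihb, ← ncard_setOf_isDissociation]
    exact congr_arg₂ _ (ncard_dissocAvoiding_link ..).symm
      (congr_arg₂ _ (ncard_dissocIsolating_link ..).symm (ncard_dissocMatching_link ..).symm)

lemma dissocNum_graph (t : PlaneTree) : dissocNum t.graph = t.total := by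
  rw [total, counts_eq, ← ncard_setOf_isDissociation]
  exact Nat.card_coe_set_eq _

/-- Isomorphism of rooted trees. -/
def RootedIso (s t : PlaneTree) : Prop := ∃ e : s.graph ≃g t.graph, e s.root = t.root

lemma RootedIso.refl (t : PlaneTree) : RootedIso t t := ⟨Iso.refl, rfl⟩

lemma RootedIso.trans {s t u : PlaneTree} : RootedIso s t → RootedIso t u → RootedIso s u
  | ⟨e, he⟩, ⟨f, hf⟩ => ⟨e.trans f, by simp [he, hf]⟩

lemma RootedIso.join {a a' b b' : PlaneTree} :
    RootedIso a a' → RootedIso b b' → RootedIso (join a b) (join a' b')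
  | ⟨e, he⟩, ⟨f, hf⟩ => ⟨linkCongr e f he hf, congrArg Sum.inl he⟩

lemma RootedIso.swap (a b c : PlaneTree) :
    RootedIso ((a.join b).join c) ((a.join c).join b) :=
  ⟨linkSwap .., rfl⟩

/-- Insert a child below the root, after the children of smaller or equal size. -/
def insertChild : PlaneTree → PlaneTree → PlaneTree
  | leaf, c => join leaf c
  | join a b, c => if c.size < b.size then join (insertChild a c) b else join (join a b) c

/-- Sort the children of every vertex by size. -/
def sort : PlaneTree → PlaneTree
  | leaf => leaf
  | join a b => insertChild a.sort b.sort

/-- Move the root to the last child, and sort. -/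
def reroot : PlaneTree → PlaneTree
  | leaf => leaf
  | join a b => (join b a).sort

lemma rootedIso_insertChild (a c : PlaneTree) : RootedIso (join a c) (insertChild a c) := by
  induction a with
  | leaf => exact .refl _
  | join a b iha _ =>
    rw [insertChild]
    split_ifs
    · exact (RootedIso.swap a b c).trans (iha.join (.refl b))
    · exact .refl _

lemma rootedIso_sort (t : PlaneTree) : RootedIso t t.sort := by
  induction t with
  | leaf => exact .refl _
  | join a b iha ihb => exact (iha.join ihb).trans (rootedIso_insertChild _ _)

lemma nonempty_iso_sort (t : PlaneTree) : Nonempty (t.graph ≃g t.sort.graph) :=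
  let ⟨e, _⟩ := rootedIso_sort t
  ⟨e⟩

lemma nonempty_iso_reroot : (t : PlaneTree) → Nonempty (t.graph ≃g t.reroot.graph)
  | leaf => ⟨Iso.refl⟩
  | join a b =>
    let ⟨e⟩ := nonempty_iso_sort (join b a)
    ⟨(linkComm a.graph a.root b.graph b.root).trans e⟩

/-- A pendant vertex can be attached at any vertex of a plane tree. -/
lemma exists_iso_link_unit : (t : PlaneTree) → (v : t.Vertex) →
    ∃ t' : PlaneTree, t'.size = t.size + 1 ∧
      ∃ e : link t.graph v (⊥ : SimpleGraph Unit) () ≃g t'.graph, e (.inl t.root) = t'.root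
  | leaf, _ => ⟨join leaf leaf, rfl, Iso.refl, rfl⟩
  | join a b, .inl v => by
    obtain ⟨a', ha, e, he⟩ := exists_iso_link_unit a v
    exact ⟨join a' b, by simp only [size]; omega,
      (linkSwap a.graph a.root b.graph b.root v ⊥ ()).trans (linkCongr e Iso.refl he rfl),
      congrArg Sum.inl he⟩
  | join a b, .inr v => by
    obtain ⟨b', hb, e, he⟩ := exists_iso_link_unit b v
    exact ⟨join a b', by simp only [size]; omega,
      (linkAssoc a.graph a.root b.graph b.root v ⊥ ()).trans (linkCongr Iso.refl e rfl he), rfl⟩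

/-- Every finite tree is isomorphic to a plane tree. -/
lemma exists_iso_graph (n : ℕ) {V : Type*} [Fintype V] (T : SimpleGraph V) (hT : T.IsTree)
    (hV : Fintype.card V = n + 1) :
    ∃ t : PlaneTree, t.size = n + 1 ∧ Nonempty (T ≃g t.graph) := by
  classical
  induction n generalizing V with
  | zero =>
    have := Fintype.card_le_one_iff_subsingleton.1 hV.le
    obtain ⟨e⟩ : Nonempty (V ≃ Unit) := Fintype.card_eq.1 (by simpa using hV)
    refine ⟨leaf, rfl, ⟨⟨e, fun {x y} => ?_⟩⟩⟩
    rw [Subsingleton.elim x y]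
    simp
  | succ n ih =>
    have : Nontrivial V := Fintype.one_lt_card_iff_nontrivial.1 (by omega)
    obtain ⟨v, hv⟩ := hT.exists_vert_degree_one_of_nontrivial
    obtain ⟨u, hvu, hu⟩ := degree_eq_one_iff_existsUnique_adj.1 hv
    obtain ⟨t, ht, ⟨e⟩⟩ := ih (T.induce {v}ᶜ)
      ⟨hT.connected.induce_compl_singleton_of_degree_eq_one hv, hT.isAcyclic.induce _⟩
      (by rw [Fintype.card_compl_set]; simp [hV])
    obtain ⟨t', ht', f, -⟩ := exists_iso_link_unit t (e ⟨u, hvu.ne'⟩)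
    have g := linkInduceComplIso T v u hvu hu
    exact ⟨t', by omega, ⟨(g.symm.trans (linkCongr e Iso.refl rfl rfl)).trans f⟩⟩

/-- The plane trees with `n + 1` vertices, provided that `n` does not exceed the first argument. -/
def trees : ℕ → ℕ → List PlaneTree
  | _, 0 => [leaf]
  | 0, _ + 1 => []
  | f + 1, n + 1 => (List.range (n + 1)).flatMap fun k =>
      (trees f k).flatMap fun a => (trees f (n - k)).map fun b => join a b

lemma size_pos (t : PlaneTree) : 0 < t.size := by
  induction t with
  | leaf => exact Nat.one_pos
  | join a b iha _ => exact Nat.add_pos_left iha _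

lemma mem_trees (t : PlaneTree) (f n : ℕ) (hf : n ≤ f) (ht : t.size = n + 1) : t ∈ trees f n := by
  induction t generalizing f n with
  | leaf =>
    obtain rfl : n = 0 := by simpa [size] using ht.symm
    simp [trees]
  | join a b iha ihb =>
    have ha := a.size_pos
    have hb := b.size_pos
    rw [size] at ht
    obtain ⟨n, rfl⟩ := Nat.exists_eq_add_of_le' (show 1 ≤ n by omega)
    obtain ⟨f, rfl⟩ := Nat.exists_eq_add_of_le' (show 1 ≤ f by omega)
    simp only [trees, List.mem_flatMap, List.mem_map, List.mem_range]
    exact ⟨a.size - 1, by omega, a, iha _ _ (by omega) (by omega), b,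
      ihb _ _ (by omega) (by omega), rfl⟩

/-- `K₁ ∗ 4K₂`, rooted at its hub. -/
def spider : PlaneTree :=
  (((leaf.join (leaf.join leaf)).join (leaf.join leaf)).join (leaf.join leaf)).join (leaf.join leaf)

/-- `K₁ ∗ (2K₁ ∪ 3K₂)`, rooted at its hub. -/
def mixedSpider : PlaneTree :=
  ((((leaf.join leaf).join leaf).join (leaf.join leaf)).join (leaf.join leaf)).join (leaf.join leaf)

lemma total_le_or_iso (t : PlaneTree) (ht : t.size = 9) :
    t.total ≤ 291 ∨ Nonempty (t.graph ≃g spider.graph) ∨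
      Nonempty (t.graph ≃g mixedSpider.graph) := by
  have key : (trees 8 8).all fun t => t.total ≤ 291 ∨
      ∃ s ∈ [t.sort, t.sort.reroot, t.sort.reroot.reroot], s = spider ∨ s = mixedSpider := by
    decide +kernel
  have h := List.all_eq_true.1 key t (mem_trees t 8 8 le_rfl ht)
  rw [decide_eq_true_eq] at h
  refine h.imp_right fun ⟨s, hs, hs'⟩ => ?_
  have hts : Nonempty (t.graph ≃g s.graph) := by
    obtain ⟨e⟩ := nonempty_iso_sort t
    obtain ⟨f⟩ := nonempty_iso_reroot t.sort
    obtain ⟨g⟩ := nonempty_iso_reroot t.sort.reroot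
    simp only [List.mem_cons, List.not_mem_nil, or_false] at hs
    rcases hs with rfl | rfl | rfl
    exacts [⟨e⟩, ⟨e.trans f⟩, ⟨(e.trans f).trans g⟩]
  rcases hs' with rfl | rfl
  exacts [.inl hts, .inr hts]

instance decidableEqVertex : (t : PlaneTree) → DecidableEq t.Vertex
  | leaf => inferInstanceAs (DecidableEq Unit)
  | join a b =>
    have := decidableEqVertex a
    have := decidableEqVertex b
    inferInstanceAs (DecidableEq (a.Vertex ⊕ b.Vertex))

instance decidableRelAdj : (t : PlaneTree) → DecidableRel t.graph.Adj
  | leaf => inferInstanceAs (DecidableRel (⊥ : SimpleGraph Unit).Adj)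
  | join a b =>
    have := decidableRelAdj a
    have := decidableRelAdj b
    fun
    | .inl x, .inl y => inferInstanceAs (Decidable (a.graph.Adj x y))
    | .inr x, .inr y => inferInstanceAs (Decidable (b.graph.Adj x y))
    | .inl x, .inr y => inferInstanceAs (Decidable (x = a.root ∧ y = b.root))
    | .inr y, .inl x => inferInstanceAs (Decidable (x = a.root ∧ y = b.root))

instance (s : List ℕ) : DecidableRel (starGraph 0 s).Adj := fun x y =>
  inferInstanceAs (Decidable (x ≠ y ∧
    (Sum.elim (fun _ => (none : Option (Fin s.length))) (fun p => some p.1) x =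
        Sum.elim (fun _ => (none : Option (Fin s.length))) (fun p => some p.1) y ∨
      (x = Sum.inl 0 ∧ ∃ i, y = Sum.inr ⟨i, 0⟩) ∨
      (y = Sum.inl 0 ∧ ∃ i, x = Sum.inr ⟨i, 0⟩))))

/-- Place the vertices of `spider` in `K₁ ∗ 4K₂`. -/
def spiderMap : spider.Vertex → Fin 1 ⊕ (Σ i : Fin 4, Fin ([1, 1, 1, 1].get i + 1)) :=
  Sum.elim (Sum.elim (Sum.elim (Sum.elim (fun _ => .inl 0)
    (Sum.elim (fun _ => .inr ⟨0, 0⟩) fun _ => .inr ⟨0, 1⟩))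
    (Sum.elim (fun _ => .inr ⟨1, 0⟩) fun _ => .inr ⟨1, 1⟩))
    (Sum.elim (fun _ => .inr ⟨2, 0⟩) fun _ => .inr ⟨2, 1⟩))
    (Sum.elim (fun _ => .inr ⟨3, 0⟩) fun _ => .inr ⟨3, 1⟩)

lemma nonempty_iso_spider : Nonempty (spider.graph ≃g starGraph 0 [1, 1, 1, 1]) := by
  have h : Function.Bijective spiderMap ∧
      ∀ x y, (starGraph 0 [1, 1, 1, 1]).Adj (spiderMap x) (spiderMap y) ↔ spider.graph.Adj x y := by
    decide +kernel
  exact ⟨⟨Equiv.ofBijective spiderMap h.1, h.2 _ _⟩⟩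

/-- Place the vertices of `mixedSpider` in `K₁ ∗ (2K₁ ∪ 3K₂)`. -/
def mixedSpiderMap :
    mixedSpider.Vertex → Fin 1 ⊕ (Σ i : Fin 5, Fin ([0, 0, 1, 1, 1].get i + 1)) :=
  Sum.elim (Sum.elim (Sum.elim (Sum.elim (Sum.elim (fun _ => .inl 0)
    fun _ => .inr ⟨0, 0⟩)
    fun _ => .inr ⟨1, 0⟩)
    (Sum.elim (fun _ => .inr ⟨2, 0⟩) fun _ => .inr ⟨2, 1⟩))
    (Sum.elim (fun _ => .inr ⟨3, 0⟩) fun _ => .inr ⟨3, 1⟩))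
    (Sum.elim (fun _ => .inr ⟨4, 0⟩) fun _ => .inr ⟨4, 1⟩)

lemma nonempty_iso_mixedSpider : Nonempty (mixedSpider.graph ≃g starGraph 0 [0, 0, 1, 1, 1]) := by
  have h : Function.Bijective mixedSpiderMap ∧
      ∀ x y, (starGraph 0 [0, 0, 1, 1, 1]).Adj (mixedSpiderMap x) (mixedSpiderMap y) ↔
        mixedSpider.graph.Adj x y := by
    decide +kernel
  exact ⟨⟨Equiv.ofBijective mixedSpiderMap h.1, h.2 _ _⟩⟩

lemma total_mixedSpider : mixedSpider.total = 292 := by decide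

end PlaneTree

/-- A tree of order 9 other than `K₁ ∗ 4K₂` has at most 292 dissociation sets, with
equality iff it is `K₁ ∗ (2K₁ ∪ 3K₂)`. -/
theorem tree_order_nine {V : Type*} [Fintype V] (T : SimpleGraph V)
    (h9 : Fintype.card V = 9) (hT : T.IsTree)
    (hnot : ¬ Nonempty (T ≃g starGraph 0 [1, 1, 1, 1])) :
    dissocNum T ≤ 292 ∧
      (dissocNum T = 292 ↔ Nonempty (T ≃g starGraph 0 [0, 0, 1, 1, 1])) := by
  obtain ⟨t, ht, ⟨e⟩⟩ := PlaneTree.exists_iso_graph 8 T hT h9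
  obtain ⟨f⟩ := PlaneTree.nonempty_iso_spider
  obtain ⟨g⟩ := PlaneTree.nonempty_iso_mixedSpider
  have hg : dissocNum (starGraph 0 [0, 0, 1, 1, 1]) = 292 := by
    rw [← dissocNum_congr g, PlaneTree.dissocNum_graph, PlaneTree.total_mixedSpider]
  have hd : dissocNum T = t.total := by rw [dissocNum_congr e, PlaneTree.dissocNum_graph]
  rcases t.total_le_or_iso ht with h | ⟨⟨i⟩⟩ | ⟨⟨i⟩⟩
  · have hlt : dissocNum T ≤ 291 := hd.trans_le h
    refine ⟨by omega, fun h => by omega, fun ⟨j⟩ => ?_⟩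
    rw [dissocNum_congr j, hg]
  · exact absurd ⟨(e.trans i).trans f⟩ hnot
  · have j := (e.trans i).trans g
    have hj := (dissocNum_congr j).trans hg
    exact ⟨hj.le, fun _ => ⟨j⟩, fun _ => hj⟩
end
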